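/- For every δ > 0, d²(q_F, q_δ) = ε_min + 2σσ_F(1 − f(δ)), where f(δ) := (2δσ_F² + σ₀σ_Fρ)/(σ_F σ_δ); equivalently, the correlation of q_F and γ + 2δ q_F under Lebesgue measure on (0,1) equals (2δσ_F² + σ₀σ_Fρ)/(σ_F sqrt(σ₀² + 4δ²σ_F² + 4δσ₀σ_Fρ)). -/

import Mathlib

open MeasureTheory Set Filter

noncomputable section

/-- Integral over the interval (0,1) with Lebesgue measure. -/
def intI (f : ℝ → ℝ) : ℝ := ∫ u in Ioo (0:ℝ) 1, f u

/-- Square integrability on (0,1). -/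
def SqInt (f : ℝ → ℝ) : Prop :=
  IntegrableOn f (Ioo (0:ℝ) 1) volume ∧ IntegrableOn (fun u => f u ^ 2) (Ioo (0:ℝ) 1) volume

/-- A quantile function: nondecreasing and square-integrable on (0,1). -/
def IsQuantile (q : ℝ → ℝ) : Prop := MonotoneOn q (Ioo (0:ℝ) 1) ∧ SqInt q

/-- Membership in `M(μ,σ)` : quantile function with prescribed first two moments. -/
def MemM (μ σ : ℝ) (q : ℝ → ℝ) : Prop :=
  IsQuantile q ∧ intI q = μ ∧ intI (fun u => q u ^ 2) = μ ^ 2 + σ ^ 2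

/-- Squared Wasserstein distance between (quantile) functions on (0,1). -/
def W2 (p q : ℝ → ℝ) : ℝ := intI (fun u => (p u - q u) ^ 2)

/-- Almost-everywhere equality on (0,1). -/
def AeEqI (f g : ℝ → ℝ) : Prop := f =ᵐ[(volume : Measure ℝ).restrict (Ioo (0:ℝ) 1)] g

/-- The penalized objective `J_δ(q) = ∫ γ q − δ d²(q_F, q)`. -/
def Jpen (γ qF : ℝ → ℝ) (δ : ℝ) (q : ℝ → ℝ) : ℝ :=
  intI (fun u => γ u * q u) - δ * W2 qF q

/-- `σ_δ = sqrt(σ₀² + 4δ²σ_F² + 4δσ₀σ_Fρ)`. -/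
def sigD (σ0 σF ρ δ : ℝ) : ℝ := Real.sqrt (σ0 ^ 2 + 4 * δ ^ 2 * σF ^ 2 + 4 * δ * σ0 * σF * ρ)

/-- The candidate optimizer `q_δ(u) = μ − (σ/σ_δ) μ_δ + (σ/σ_δ)(γ(u) + 2δ q_F(u))`,
where `μ_δ = 1 + 2δμ_F`. -/
def qD (μ σ μF σ0 σF ρ δ : ℝ) (γ qF : ℝ → ℝ) : ℝ → ℝ := fun u =>
  μ - σ / sigD σ0 σF ρ δ * (1 + 2 * δ * μF) + σ / sigD σ0 σF ρ δ * (γ u + 2 * δ * qF u)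

lemma SqInt.integrableOn_mul {f g : ℝ → ℝ} (hf : SqInt f) (hg : SqInt g) :
    IntegrableOn (fun u => f u * g u) (Ioo (0:ℝ) 1) volume :=
  ((memLp_two_iff_integrable_sq hf.1.aestronglyMeasurable).2 hf.2).integrable_mul
    ((memLp_two_iff_integrable_sq hg.1.aestronglyMeasurable).2 hg.2)

/-- The integral of a quadratic polynomial in two square-integrable functions. -/
lemma intI_quadratic {f g : ℝ → ℝ} (hf : SqInt f) (hg : SqInt g) (a b c d e k : ℝ) :
    intI (fun u => a + b * f u + c * g u + d * f u ^ 2 + e * (f u * g u) + k * g u ^ 2) =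
      a + b * intI f + c * intI g + d * intI (fun u => f u ^ 2) +
        e * intI (fun u => f u * g u) + k * intI (fun u => g u ^ 2) := by
  have h0 : Integrable (fun _ : ℝ => a) (volume.restrict (Ioo (0:ℝ) 1)) := integrable_const a
  have h1 := hf.1.integrable.const_mul b
  have h2 := hg.1.integrable.const_mul c
  have h3 := hf.2.integrable.const_mul d
  have h4 := (hf.integrableOn_mul hg).integrable.const_mul e
  have h5 := hg.2.integrable.const_mul k
  have h01 : Integrable (fun u => a + b * f u) (volume.restrict (Ioo (0:ℝ) 1)) := h0.add h1
  have h02 : Integrable (fun u => a + b * f u + c * g u) (volume.restrict (Ioo (0:ℝ) 1)) :=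
    h01.add h2
  have h03 : Integrable (fun u => a + b * f u + c * g u + d * f u ^ 2)
      (volume.restrict (Ioo (0:ℝ) 1)) := h02.add h3
  have h04 : Integrable (fun u => a + b * f u + c * g u + d * f u ^ 2 + e * (f u * g u))
      (volume.restrict (Ioo (0:ℝ) 1)) := h03.add h4
  simp only [intI]
  rw [integral_add h04 h5, integral_add h03 h4, integral_add h02 h3, integral_add h01 h2,
    integral_add h0 h1]
  simp only [integral_const_mul]
  simp

lemma intI_nonneg {f : ℝ → ℝ} (hf : ∀ u ∈ Ioo (0:ℝ) 1, 0 ≤ f u) : 0 ≤ intI f :=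
  setIntegral_nonneg measurableSet_Ioo hf

/-- Chebyshev's integral inequality on `(0,1)`. -/
lemma IsQuantile.intI_mul_intI_le {f g : ℝ → ℝ} (hf : IsQuantile f) (hg : IsQuantile g) :
    intI f * intI g ≤ intI (fun u => f u * g u) := by
  have key : ∀ c ∈ Ioo (0:ℝ) 1,
      0 ≤ intI (fun u => f u * g u) - f c * intI g - g c * intI f + f c * g c := by
    intro c hc
    have h : 0 ≤ intI (fun u => (f u - f c) * (g u - g c)) := by
      refine intI_nonneg fun u hu => ?_
      rcases le_total u c with huc | huc
      · exact mul_nonneg_of_nonpos_of_nonpos (sub_nonpos.2 (hf.1 hu hc huc))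
          (sub_nonpos.2 (hg.1 hu hc huc))
      · exact mul_nonneg (sub_nonneg.2 (hf.1 hc hu huc)) (sub_nonneg.2 (hg.1 hc hu huc))
    have e := intI_quadratic hf.2 hg.2 (f c * g c) (-g c) (-f c) 0 1 0
    have e' : (fun u => (f u - f c) * (g u - g c)) = fun u => f c * g c + -g c * f u +
        -f c * g u + 0 * f u ^ 2 + 1 * (f u * g u) + 0 * g u ^ 2 := by
      funext u; ring
    rw [e', e] at h
    linarith
  have h := intI_nonneg key
  have e := intI_quadratic hf.2 hg.2 (intI (fun u => f u * g u)) (-intI g) (-intI f) 0 1 0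
  have e' : (fun c => intI (fun u => f u * g u) - f c * intI g - g c * intI f + f c * g c) =
      fun c => intI (fun u => f u * g u) + -intI g * f c + -intI f * g c + 0 * f c ^ 2 +
        1 * (f c * g c) + 0 * g c ^ 2 := by
    funext c; ring
  rw [e', e] at h
  linarith

theorem statement4
    (μ μF σ σF : ℝ) (hσpos : 0 < σ) (hσFpos : 0 < σF)
    (qF : ℝ → ℝ) (hqF : IsQuantile qF)
    (hqFm : intI qF = μF) (hqF2 : intI (fun u => qF u ^ 2) = μF ^ 2 + σF ^ 2)
    (γ : ℝ → ℝ) (hγmono : MonotoneOn γ (Ioo (0:ℝ) 1)) (hγsq : SqInt γ)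
    (hγ1 : intI γ = 1)
    (σ0 : ℝ) (hσ0 : σ0 = Real.sqrt (intI (fun u => γ u ^ 2) - 1)) (hσ0pos : 0 < σ0)
    (ρ : ℝ) (hρ : ρ = (intI (fun u => γ u * qF u) - μF) / (σ0 * σF))
    (εmin : ℝ) (hεmin : εmin = (μF - μ) ^ 2 + (σF - σ) ^ 2)
    (δ : ℝ) (hδ : 0 < δ) :
    W2 qF (qD μ σ μF σ0 σF ρ δ γ qF) =
      εmin + 2 * σ * σF *
        (1 - (2 * δ * σF ^ 2 + σ0 * σF * ρ) / (σF * sigD σ0 σF ρ δ)) ∧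
    (intI (fun u => qF u * (γ u + 2 * δ * qF u)) -
        intI qF * intI (fun u => γ u + 2 * δ * qF u)) /
      (Real.sqrt (intI (fun u => qF u ^ 2) - (intI qF) ^ 2) *
        Real.sqrt (intI (fun u => (γ u + 2 * δ * qF u) ^ 2) -
          (intI (fun u => γ u + 2 * δ * qF u)) ^ 2)) =
      (2 * δ * σF ^ 2 + σ0 * σF * ρ) /
        (σF * Real.sqrt (σ0 ^ 2 + 4 * δ ^ 2 * σF ^ 2 + 4 * δ * σ0 * σF * ρ)) := by
  have hγ2 : intI (fun u => γ u ^ 2) = 1 + σ0 ^ 2 := by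
    have hpos : 0 < intI (fun u => γ u ^ 2) - 1 := Real.sqrt_pos.1 (hσ0 ▸ hσ0pos)
    rw [hσ0, Real.sq_sqrt hpos.le]
    ring
  have hγqF : intI (fun u => γ u * qF u) = μF + σ0 * σF * ρ := by
    rw [hρ]
    field_simp
    ring
  have hcov : 0 ≤ σ0 * σF * ρ := by
    have h := IsQuantile.intI_mul_intI_le ⟨hγmono, hγsq⟩ hqF
    rw [hγ1, hqFm, hγqF] at h
    linarith
  have hquad := intI_quadratic hγsq hqF.2
  simp only [hγ1, hqFm, hγ2, hγqF, hqF2] at hquad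
  have hvar : 0 < σ0 ^ 2 + 4 * δ ^ 2 * σF ^ 2 + 4 * δ * σ0 * σF * ρ := by
    have h : 0 ≤ δ * (σ0 * σF * ρ) := mul_nonneg hδ.le hcov
    have : 0 < σ0 ^ 2 + 4 * δ ^ 2 * σF ^ 2 := by positivity
    linarith
  constructor
  · have hs : 0 < sigD σ0 σF ρ δ := Real.sqrt_pos.2 hvar
    have hs2 : sigD σ0 σF ρ δ ^ 2 =
        σ0 ^ 2 + 4 * δ ^ 2 * σF ^ 2 + 4 * δ * σ0 * σF * ρ := Real.sq_sqrt hvar.le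
    unfold W2 qD
    set s := sigD σ0 σF ρ δ
    obtain ⟨t, ht⟩ : ∃ t, t = σ / s := ⟨_, rfl⟩
    have hts : t * s = σ := by rw [ht]; field_simp
    have hrhs : 2 * σ * σF * (1 - (2 * δ * σF ^ 2 + σ0 * σF * ρ) / (σF * s)) =
        2 * σ * σF - 2 * t * (2 * δ * σF ^ 2 + σ0 * σF * ρ) := by
      rw [ht]
      field_simp
    have hσt : σ ^ 2 = t ^ 2 * (σ0 ^ 2 + 4 * δ ^ 2 * σF ^ 2 + 4 * δ * σ0 * σF * ρ) := by
      rw [← hs2, ← hts]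
      ring
    rw [hrhs, hεmin, ← ht]
    obtain ⟨m, hm⟩ : ∃ m, m = μ - t * (1 + 2 * δ * μF) := ⟨_, rfl⟩
    have e : (fun u => (qF u - (μ - t * (1 + 2 * δ * μF) + t * (γ u + 2 * δ * qF u))) ^ 2) =
        fun u => m ^ 2 + 2 * m * t * γ u + -2 * m * (1 - 2 * δ * t) * qF u + t ^ 2 * γ u ^ 2 +
          -2 * t * (1 - 2 * δ * t) * (γ u * qF u) + (1 - 2 * δ * t) ^ 2 * qF u ^ 2 := by
      funext u
      rw [hm]
      ring
    rw [e, hquad, hm]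
    linear_combination -hσt
  · have e1 : intI (fun u => γ u + 2 * δ * qF u) = 1 + 2 * δ * μF := by
      have h := hquad 0 1 (2 * δ) 0 0 0
      simpa using h
    have e2 : intI (fun u => qF u * (γ u + 2 * δ * qF u)) =
        μF + σ0 * σF * ρ + 2 * δ * (μF ^ 2 + σF ^ 2) := by
      rw [show (fun u => qF u * (γ u + 2 * δ * qF u)) = fun u => 0 + 0 * γ u + 0 * qF u +
        0 * γ u ^ 2 + 1 * (γ u * qF u) + 2 * δ * qF u ^ 2 by funext u; ring, hquad]
      ring
    have e3 : intI (fun u => (γ u + 2 * δ * qF u) ^ 2) = 1 + σ0 ^ 2 +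
        4 * δ * (μF + σ0 * σF * ρ) + 4 * δ ^ 2 * (μF ^ 2 + σF ^ 2) := by
      rw [show (fun u => (γ u + 2 * δ * qF u) ^ 2) = fun u => 0 + 0 * γ u + 0 * qF u +
        1 * γ u ^ 2 + 4 * δ * (γ u * qF u) + 4 * δ ^ 2 * qF u ^ 2 by funext u; ring, hquad]
      ring
    rw [e1, e2, e3, hqFm, hqF2, add_sub_cancel_left, Real.sqrt_sq hσFpos.le]
    congr 3 <;> ring_nf
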